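/- Let k be a field of characteristic 0 or of characteristic at least 5. Then each of the three quotient rings R̃^{1,2,1}_k/(A,B), R̃^{1,2,1}_k/(C,D), and R̃^{1,2,1}_k/(R) is an integral domain of Krull dimension 4. -/

import Mathlib

open MvPolynomial

set_option maxHeartbeats 1000000
set_option synthInstance.maxHeartbeats 400000

/-- variables: `A=0, B=1, C=2, D=3, R=4, X=5, Y=6, Z=7`. -/
noncomputable def idealR121 (k : Type*) [Field k] : Ideal (MvPolynomial (Fin 8) k) :=
  Ideal.span
    { X 5 * X 0 + X 7 * X 1 - X 0 * X 4,   -- XA+ZB−AR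
      X 6 * X 0 - X 5 * X 1 - X 1 * X 4,   -- YA−XB−BR
      X 5 * X 2 + X 6 * X 3 + X 2 * X 4,   -- XC+YD+CR
      X 7 * X 2 - X 5 * X 3 + X 3 * X 4,   -- ZC−XD+DR
      X 5 ^ 2 + X 6 * X 7 - X 4 ^ 2,       -- X²+YZ−R²
      X 0 * X 2 + X 1 * X 3 }              -- AC+BD

/-- The ring `R̃^{1,2,1}_k`. -/
abbrev RTilde121 (k : Type*) [Field k] : Type _ := MvPolynomial (Fin 8) k ⧸ idealR121 k

namespace R121Aux

lemma toric_inj {k S σ τ : Type*} [Field k] [CommRing S] [Algebra k S]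
    (g : σ → S) (hg : Function.Surjective (aeval (R := k) g)) (deg : σ → τ →₀ ℕ)
    (ψ : S →ₐ[k] MvPolynomial τ k) (hψ : ∀ i, ψ (g i) = monomial (deg i) 1)
    (H : ∀ m m' : σ →₀ ℕ, (m.sum fun i n => n • deg i) = (m'.sum fun i n => n • deg i) →
      (m.prod fun i n => g i ^ n) = (m'.prod fun i n => g i ^ n)) :
    Function.Injective ψ := by
  classical
  let r : (τ →₀ ℕ) → S := fun n =>
    if h : ∃ m : σ →₀ ℕ, (m.sum fun i n => n • deg i) = n then
      (h.choose.prod fun i n => g i ^ n) else 0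
  have hr : ∀ m : σ →₀ ℕ, r (m.sum fun i n => n • deg i) = m.prod fun i n => g i ^ n := by
    intro m
    have h : ∃ m' : σ →₀ ℕ, (m'.sum fun i n => n • deg i) = (m.sum fun i n => n • deg i) :=
      ⟨m, rfl⟩
    simp only [r, dif_pos h]
    exact H _ _ h.choose_spec
  let L : MvPolynomial τ k →ₗ[k] S := (basisMonomials τ k).constr k r
  have hL : ∀ n, L (monomial n 1) = r n := by
    intro n
    have := (basisMonomials τ k).constr_basis k r n
    simpa [L] using this
  have hmon : ∀ m : σ →₀ ℕ, ψ (m.prod fun i n => g i ^ n)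
      = monomial (m.sum fun i n => n • deg i) 1 := by
    intro m
    rw [Finsupp.prod, map_prod, Finsupp.sum, monomial_sum_one]
    refine Finset.prod_congr rfl fun i _ => ?_
    rw [map_pow, hψ, monomial_pow, one_pow]
  have key : (L ∘ₗ ψ.toLinearMap) ∘ₗ (aeval (R := k) g).toLinearMap
      = (aeval (R := k) g).toLinearMap := by
    refine (basisMonomials σ k).ext fun m => ?_
    simp only [coe_basisMonomials, LinearMap.comp_apply, AlgHom.toLinearMap_apply, aeval_monomial, map_one, one_mul]
    rw [hmon, hL, hr]
  intro a b hab
  obtain ⟨a, rfl⟩ := hg a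
  obtain ⟨b, rfl⟩ := hg b
  have h1 := LinearMap.congr_fun key a
  have h2 := LinearMap.congr_fun key b
  simp only [LinearMap.comp_apply, AlgHom.toLinearMap_apply] at h1 h2
  rw [← h1, ← h2, hab]

lemma dim_le_of_isIntegral {R S : Type*} [CommRing R] [CommRing S] (f : R →+* S)
    (hf : f.IsIntegral) : ringKrullDim S ≤ ringKrullDim R := by
  algebraize [f]
  refine Order.krullDim_le_of_strictMono (PrimeSpectrum.comap (algebraMap R S)) ?_
  intro p q hpq
  have := p.2
  exact Ideal.comap_lt_comap_of_integral_mem_sdiff hpq.le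
    (Set.exists_of_ssubset hpq).choose_spec (Algebra.IsIntegral.isIntegral _)

lemma int_all {k R S σ : Type*} [Field k] [CommRing R] [CommRing S] [Algebra k R] [Algebra k S]
    (f : R →ₐ[k] S) (g : σ → S) (hg : Function.Surjective (aeval (R := k) g))
    (h : ∀ i, f.toRingHom.IsIntegralElem (g i)) : f.toRingHom.IsIntegral := by
  intro s
  obtain ⟨F, rfl⟩ := hg s
  induction F using MvPolynomial.induction_on with
  | C a =>
    have : aeval g (C a : MvPolynomial σ k) = f.toRingHom (algebraMap k R a) := by simp
    rw [this]
    exact RingHom.isIntegralElem_map _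
  | add p q hp hq => rw [map_add]; exact RingHom.IsIntegralElem.add _ hp hq
  | mul_X p i hp => rw [map_mul, aeval_X]; exact RingHom.IsIntegralElem.mul _ hp (h i)

open Polynomial in
lemma int_cubic {R S : Type*} [CommRing R] [CommRing S] (f : R →+* S) (a b c : R) (y : S)
    (h : y ^ 3 + f a * y ^ 2 + f b * y + f c = 0) : f.IsIntegralElem y := by
  refine ⟨Polynomial.X ^ 3 + Polynomial.C a * Polynomial.X ^ 2 + Polynomial.C b * Polynomial.X
    + Polynomial.C c, ?_, ?_⟩
  · monicity!
  · simpa using h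

open Polynomial in
lemma int_quartic {R S : Type*} [CommRing R] [CommRing S] (f : R →+* S) (a b c d : R) (y : S)
    (h : y ^ 4 + f a * y ^ 3 + f b * y ^ 2 + f c * y + f d = 0) : f.IsIntegralElem y := by
  refine ⟨Polynomial.X ^ 4 + Polynomial.C a * Polynomial.X ^ 3 + Polynomial.C b * Polynomial.X ^ 2
    + Polynomial.C c * Polynomial.X + Polynomial.C d, ?_, ?_⟩
  · monicity!
  · simpa using h

lemma int_quad {R S : Type*} [CommRing R] [Nontrivial R] [CommRing S] (f : R →+* S) (a : R)
    (y : S) (h : f.IsIntegralElem (y ^ 2 + f a * y)) : f.IsIntegralElem y := by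
  obtain ⟨p, hp, hp'⟩ := h
  have hdeg : (Polynomial.X ^ 2 + Polynomial.C a * Polynomial.X : Polynomial R).natDegree = 2 := by
    compute_degree!
  refine ⟨p.comp (Polynomial.X ^ 2 + Polynomial.C a * Polynomial.X), ?_, ?_⟩
  · refine hp.comp ?_ (by rw [hdeg]; norm_num)
    monicity!
  · rw [Polynomial.eval₂_comp]
    simpa using hp'

/-- monomials in the entries of a `2 × 3` matrix -/
def mon6 {M : Type*} [CommRing M] (x1 x2 x3 y1 y2 y3 : M) (a1 a2 a3 b1 b2 b3 : ℕ) : M :=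
  x1 ^ a1 * x2 ^ a2 * x3 ^ a3 * y1 ^ b1 * y2 ^ b2 * y3 ^ b3

/-- extract `x1` whenever possible -/
lemma mon6_fst {M : Type*} [CommRing M] (x1 x2 x3 y1 y2 y3 : M) (h12 : x1 * y2 = x2 * y1)
    (h13 : x1 * y3 = x3 * y1) (a1 a2 a3 b1 b2 b3 : ℕ) (h : 0 < a1 + b1)
    (he : 0 < a1 + a2 + a3) : ∃ a1' a2' a3' b1' b2' b3' : ℕ, a1' + b1' + 1 = a1 + b1 ∧
      a2' + b2' = a2 + b2 ∧ a3' + b3' = a3 + b3 ∧ a1' + a2' + a3' + 1 = a1 + a2 + a3 ∧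
      mon6 x1 x2 x3 y1 y2 y3 a1 a2 a3 b1 b2 b3
        = x1 * mon6 x1 x2 x3 y1 y2 y3 a1' a2' a3' b1' b2' b3' := by
  unfold mon6
  rcases a1 with _ | a1
  · rcases b1 with _ | b1
    · omega
    rcases a2 with _ | a2
    · rcases a3 with _ | a3
      · omega
      refine ⟨0, 0, a3, b1, b2, b3 + 1, by omega, by omega, by omega, by omega, ?_⟩
      linear_combination (-(x3 ^ a3 * y1 ^ b1 * y2 ^ b2 * y3 ^ b3)) * h13
    · refine ⟨0, a2, a3, b1, b2 + 1, b3, by omega, by omega, by omega, by omega, ?_⟩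
      linear_combination (-(x2 ^ a2 * x3 ^ a3 * y1 ^ b1 * y2 ^ b2 * y3 ^ b3)) * h12
  · exact ⟨a1, a2, a3, b1, b2, b3, by omega, by omega, by omega, by omega, by ring⟩

/-- if the first column is absent, extract `x2` whenever possible -/
lemma mon6_snd {M : Type*} [CommRing M] (x1 x2 x3 y1 y2 y3 : M)
    (h23 : x2 * y3 = x3 * y2) (a2 a3 b2 b3 : ℕ) (h : 0 < a2 + b2)
    (he : 0 < a2 + a3) : ∃ a2' a3' b2' b3' : ℕ,
      a2' + b2' + 1 = a2 + b2 ∧ a3' + b3' = a3 + b3 ∧ a2' + a3' + 1 = a2 + a3 ∧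
      mon6 x1 x2 x3 y1 y2 y3 0 a2 a3 0 b2 b3
        = x2 * mon6 x1 x2 x3 y1 y2 y3 0 a2' a3' 0 b2' b3' := by
  unfold mon6
  rcases a2 with _ | a2
  · rcases b2 with _ | b2
    · omega
    rcases a3 with _ | a3
    · omega
    refine ⟨0, a3, b2, b3 + 1, by omega, by omega, by omega, ?_⟩
    linear_combination (-(x3 ^ a3 * y2 ^ b2 * y3 ^ b3)) * h23
  · exact ⟨a2, a3, b2, b3, by omega, by omega, by omega, by ring⟩

/-- monomials in a `2 × 3` rank one matrix are determined by row and column sums -/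
lemma comb6 {M : Type*} [CommRing M] (x1 x2 x3 y1 y2 y3 : M) (h12 : x1 * y2 = x2 * y1)
    (h13 : x1 * y3 = x3 * y1) (h23 : x2 * y3 = x3 * y2) :
    ∀ n a1 a2 a3 b1 b2 b3 a1' a2' a3' b1' b2' b3' : ℕ, a1 + a2 + a3 + b1 + b2 + b3 = n →
      a1 + b1 = a1' + b1' → a2 + b2 = a2' + b2' → a3 + b3 = a3' + b3' →
      a1 + a2 + a3 = a1' + a2' + a3' →
      mon6 x1 x2 x3 y1 y2 y3 a1 a2 a3 b1 b2 b3
        = mon6 x1 x2 x3 y1 y2 y3 a1' a2' a3' b1' b2' b3' := by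
  intro n
  induction n using Nat.strong_induction_on with
  | _ n ih =>
  intro a1 a2 a3 b1 b2 b3 a1' a2' a3' b1' b2' b3' hn g1 g2 g3 ge
  by_cases he : 0 < a1 + a2 + a3
  · by_cases hc : 0 < a1 + b1
    · obtain ⟨p1, p2, p3, q1, q2, q3, k1, k2, k3, k4, k5⟩ :=
        mon6_fst x1 x2 x3 y1 y2 y3 h12 h13 a1 a2 a3 b1 b2 b3 hc he
      obtain ⟨p1', p2', p3', q1', q2', q3', k1', k2', k3', k4', k5'⟩ :=
        mon6_fst x1 x2 x3 y1 y2 y3 h12 h13 a1' a2' a3' b1' b2' b3' (by omega) (by omega)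
      rw [k5, k5', ih (n - 1) (by omega) p1 p2 p3 q1 q2 q3 p1' p2' p3' q1' q2' q3' (by omega)
        (by omega) (by omega) (by omega) (by omega)]
    · obtain rfl : a1 = 0 := by omega
      obtain rfl : b1 = 0 := by omega
      obtain rfl : a1' = 0 := by omega
      obtain rfl : b1' = 0 := by omega
      by_cases hd : 0 < a2 + b2
      · obtain ⟨p2, p3, q2, q3, k2, k3, k4, k5⟩ :=
          mon6_snd x1 x2 x3 y1 y2 y3 h23 a2 a3 b2 b3 hd (by omega)
        obtain ⟨p2', p3', q2', q3', k2', k3', k4', k5'⟩ :=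
          mon6_snd x1 x2 x3 y1 y2 y3 h23 a2' a3' b2' b3' (by omega) (by omega)
        rw [k5, k5', ih (n - 1) (by omega) 0 p2 p3 0 q2 q3 0 p2' p3' 0 q2' q3' (by omega)
          (by omega) (by omega) (by omega) (by omega)]
      · congr 1 <;> omega
  · congr 1 <;> omega

/-- monomials in the entries of the scroll matrix -/
def mon7 {M : Type*} [CommRing M] (c d b a y x z : M) (p q r t l m o : ℕ) : M :=
  c ^ p * d ^ q * b ^ r * a ^ t * y ^ l * x ^ m * z ^ o

lemma mon7_fst {M : Type*} [CommRing M] (c d b a y x z : M)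
    (h1 : c * a = b * d) (h2 : c * x = y * d) (h3 : c * z = x * d) (p q r t l m o : ℕ)
    (h : 0 < p + q) (he : 0 < p + r + 2 * l + m) : ∃ p' q' r' t' l' m' o' : ℕ,
      p' + q' + 1 = p + q ∧ r' + t' = r + t ∧ l' + m' + o' = l + m + o ∧
      p' + r' + 2 * l' + m' + 1 = p + r + 2 * l + m ∧
      mon7 c d b a y x z p q r t l m o = c * mon7 c d b a y x z p' q' r' t' l' m' o' := by
  unfold mon7
  rcases p with _ | p
  · rcases q with _ | q
    · omega
    rcases r with _ | r
    · rcases m with _ | m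
      · rcases l with _ | l
        · omega
        refine ⟨0, q, 0, t, l, 1, o, by omega, by omega, by omega, by omega, ?_⟩
        linear_combination (-(d ^ q * a ^ t * y ^ l * z ^ o)) * h2
      · refine ⟨0, q, 0, t, l, m, o + 1, by omega, by omega, by omega, by omega, ?_⟩
        linear_combination (-(d ^ q * a ^ t * y ^ l * x ^ m * z ^ o)) * h3
    · refine ⟨0, q, r, t + 1, l, m, o, by omega, by omega, by omega, by omega, ?_⟩
      linear_combination (-(d ^ q * b ^ r * a ^ t * y ^ l * x ^ m * z ^ o)) * h1
  · exact ⟨p, q, r, t, l, m, o, by omega, by omega, by omega, by omega, by ring⟩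

lemma mon7_snd {M : Type*} [CommRing M] (c d b a y x z : M)
    (h4 : b * x = y * a) (h5 : b * z = x * a) (r t l m o : ℕ)
    (h : 0 < r + t) (he : 0 < r + 2 * l + m) : ∃ r' t' l' m' o' : ℕ,
      r' + t' + 1 = r + t ∧ l' + m' + o' = l + m + o ∧
      r' + 2 * l' + m' + 1 = r + 2 * l + m ∧
      mon7 c d b a y x z 0 0 r t l m o = b * mon7 c d b a y x z 0 0 r' t' l' m' o' := by
  unfold mon7
  rcases r with _ | r
  · rcases t with _ | t
    · omega
    rcases m with _ | m
    · rcases l with _ | l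
      · omega
      refine ⟨0, t, l, 1, o, by omega, by omega, by omega, ?_⟩
      linear_combination (-(a ^ t * y ^ l * z ^ o)) * h4
    · refine ⟨0, t, l, m, o + 1, by omega, by omega, by omega, ?_⟩
      linear_combination (-(a ^ t * y ^ l * x ^ m * z ^ o)) * h5
  · exact ⟨r, t, l, m, o, by omega, by omega, by omega, by ring⟩

lemma mon7_thd {M : Type*} [CommRing M] (c d b a y x z : M) (h6 : y * z = x * x) (l m o : ℕ)
    (he : 2 ≤ 2 * l + m) : ∃ l' m' o' : ℕ, l' + m' + o' + 1 = l + m + o ∧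
      2 * l' + m' + 2 = 2 * l + m ∧
      mon7 c d b a y x z 0 0 0 0 l m o = y * mon7 c d b a y x z 0 0 0 0 l' m' o' := by
  unfold mon7
  rcases l with _ | l
  · obtain ⟨m, rfl⟩ : ∃ s, m = s + 2 := ⟨m - 2, by omega⟩
    refine ⟨0, m, o + 1, by omega, by omega, ?_⟩
    linear_combination (-(x ^ m * z ^ o)) * h6
  · exact ⟨l, m, o, by omega, by omega, by ring⟩

/-- the same for the scroll of type `(1,1,2)`, rows `c b y x` and `d a x z` -/
lemma comb7 {M : Type*} [CommRing M] (c d b a y x z : M)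
    (h1 : c * a = b * d) (h2 : c * x = y * d) (h3 : c * z = x * d)
    (h4 : b * x = y * a) (h5 : b * z = x * a) (h6 : y * z = x * x) :
    ∀ n p q r t l m o p' q' r' t' l' m' o' : ℕ, p + q + r + t + l + m + o = n →
      p + q = p' + q' → r + t = r' + t' → l + m + o = l' + m' + o' →
      p + r + 2 * l + m = p' + r' + 2 * l' + m' →
      mon7 c d b a y x z p q r t l m o = mon7 c d b a y x z p' q' r' t' l' m' o' := by
  intro n
  induction n using Nat.strong_induction_on with
  | _ n ih =>
  intro p q r t l m o p' q' r' t' l' m' o' hn g1 g2 g3 ge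
  by_cases he : 0 < p + r + 2 * l + m
  · by_cases hc : 0 < p + q
    · obtain ⟨_, _, _, _, _, _, _, k1, k2, k3, k4, k5⟩ :=
        mon7_fst c d b a y x z h1 h2 h3 p q r t l m o hc he
      obtain ⟨_, _, _, _, _, _, _, k1', k2', k3', k4', k5'⟩ :=
        mon7_fst c d b a y x z h1 h2 h3 p' q' r' t' l' m' o' (by omega) (by omega)
      rw [k5, k5']
      congr 1
      exact ih (n - 1) (by omega) _ _ _ _ _ _ _ _ _ _ _ _ _ _ (by omega)
        (by omega) (by omega) (by omega) (by omega)
    · obtain rfl : p = 0 := by omega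
      obtain rfl : q = 0 := by omega
      obtain rfl : p' = 0 := by omega
      obtain rfl : q' = 0 := by omega
      by_cases hd : 0 < r + t
      · obtain ⟨_, _, _, _, _, k2, k3, k4, k5⟩ :=
          mon7_snd c d b a y x z h4 h5 r t l m o hd (by omega)
        obtain ⟨_, _, _, _, _, k2', k3', k4', k5'⟩ :=
          mon7_snd c d b a y x z h4 h5 r' t' l' m' o' (by omega) (by omega)
        rw [k5, k5']
        congr 1
        exact ih (n - 1) (by omega) _ _ _ _ _ _ _ _ _ _ _ _ _ _ (by omega)
          (by omega) (by omega) (by omega) (by omega)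
      · obtain rfl : r = 0 := by omega
        obtain rfl : t = 0 := by omega
        obtain rfl : r' = 0 := by omega
        obtain rfl : t' = 0 := by omega
        by_cases hf : 2 ≤ 2 * l + m
        · obtain ⟨_, _, _, k3, k4, k5⟩ := mon7_thd c d b a y x z h6 l m o hf
          obtain ⟨_, _, _, k3', k4', k5'⟩ := mon7_thd c d b a y x z h6 l' m' o' (by omega)
          rw [k5, k5']
          congr 1
          exact ih (n - 1) (by omega) _ _ _ _ _ _ _ _ _ _ _ _ _ _ (by omega)
            (by omega) (by omega) (by omega) (by omega)
        · congr 1 <;> omega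
  · congr 1 <;> omega

lemma lower {k S : Type*} [Field k] [CommRing S] [Algebra k S] [IsDomain S]
    (θ : S →ₐ[k] MvPolynomial (Fin 3) k) (r y1 y2 y3 : S) (hr : r ≠ 0) (hr' : θ r = 0)
    (h1 : θ y1 = X 0) (h2 : θ y2 = X 1) (h3 : θ y3 = X 2) : 4 ≤ ringKrullDim S := by
  have hs : Function.Surjective θ := by
    have : θ.comp (aeval ![y1, y2, y3]) = AlgHom.id k _ := by
      ext i
      fin_cases i <;> simp [h1, h2, h3]
    intro s
    exact ⟨aeval ![y1, y2, y3] s, by simpa using AlgHom.congr_fun this s⟩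
  have := ringKrullDim_succ_le_of_surjective θ.toRingHom hs
    (mem_nonZeroDivisors_of_ne_zero hr) hr'
  rw [MvPolynomial.ringKrullDim_of_isNoetherianRing, ringKrullDim_eq_zero_of_field] at this
  refine le_trans (le_of_eq ?_) this
  simp
  norm_num

lemma upper {k S σ : Type*} [Field k] [CommRing S] [Algebra k S]
    (w : Fin 4 → S) (g : σ → S) (hg : Function.Surjective (aeval (R := k) g))
    (h : ∀ i, (aeval (R := k) w).toRingHom.IsIntegralElem (g i)) : ringKrullDim S ≤ 4 := by
  have := dim_le_of_isIntegral _ (int_all (aeval (R := k) w) g hg h)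
  rw [MvPolynomial.ringKrullDim_of_isNoetherianRing, ringKrullDim_eq_zero_of_field] at this
  refine le_trans this (le_of_eq ?_)
  simp

theorem generic23 {k S : Type*} [Field k] [CommRing S] [Algebra k S]
    (x1 x2 x3 y1 y2 y3 : S) (h12 : x1 * y2 = x2 * y1)
    (h13 : x1 * y3 = x3 * y1) (h23 : x2 * y3 = x3 * y2)
    (hg : Function.Surjective (aeval (R := k) ![x1, x2, x3, y1, y2, y3]))
    (ψ : S →ₐ[k] MvPolynomial (Fin 5) k)
    (e1 : ψ x1 = X 0 * X 2) (e2 : ψ x2 = X 0 * X 3) (e3 : ψ x3 = X 0 * X 4)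
    (e4 : ψ y1 = X 1 * X 2) (e5 : ψ y2 = X 1 * X 3) (e6 : ψ y3 = X 1 * X 4) :
    IsDomain S ∧ ringKrullDim S = 4 := by
  have hinj : Function.Injective ψ := by
    refine toric_inj _ hg (fun i => ![Finsupp.single 0 1 + Finsupp.single 2 1,
      Finsupp.single 0 1 + Finsupp.single 3 1, Finsupp.single 0 1 + Finsupp.single 4 1,
      Finsupp.single 1 1 + Finsupp.single 2 1, Finsupp.single 1 1 + Finsupp.single 3 1,
      Finsupp.single 1 1 + Finsupp.single 4 1] i) ψ ?_ ?_
    · intro i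
      fin_cases i <;> simp [e1, e2, e3, e4, e5, e6, X, monomial_mul]
    · intro m m' h
      rw [Finsupp.prod_fintype _ _ (by simp), Finsupp.prod_fintype _ _ (by simp)]
      rw [Finsupp.sum_fintype _ _ (by simp), Finsupp.sum_fintype _ _ (by simp)] at h
      simp only [Fin.prod_univ_six, Fin.sum_univ_six] at h ⊢
      have H0 := DFunLike.congr_fun h 0
      have H2 := DFunLike.congr_fun h 2
      have H3 := DFunLike.congr_fun h 3
      have H4 := DFunLike.congr_fun h 4
      simp at H0 H2 H3 H4
      exact comb6 x1 x2 x3 y1 y2 y3 h12 h13 h23 _ _ _ _ _ _ _ _ _ _ _ _ _ rfl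
        (by omega) (by omega) (by omega) (by omega)
  have hdom : IsDomain S := hinj.isDomain ψ.toRingHom
  refine ⟨hdom, le_antisymm ?_ ?_⟩
  · have hw : ∀ j, (aeval (R := k) ![x1, y1 - x2, y2 - x3, y3]).toRingHom (X j)
        = ![x1, y1 - x2, y2 - x3, y3] j := fun j => aeval_X _ _
    have w0 := hw 0
    have w1 := hw 1
    have w2 := hw 2
    have w3 := hw 3
    simp only [Matrix.cons_val] at w0 w1 w2 w3
    refine upper ![x1, y1 - x2, y2 - x3, y3] _ hg ?_
    set f := (aeval (R := k) ![x1, y1 - x2, y2 - x3, y3]).toRingHom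
    have i1 : f.IsIntegralElem x1 := w0 ▸ f.isIntegralElem_map
    have i6 : f.IsIntegralElem y3 := w3 ▸ f.isIntegralElem_map
    have j1 : f.IsIntegralElem (y1 - x2) := w1 ▸ f.isIntegralElem_map
    have j2 : f.IsIntegralElem (y2 - x3) := w2 ▸ f.isIntegralElem_map
    have i4 : f.IsIntegralElem y1 := by
      refine int_cubic f (-X 1) (-(X 0 * X 2)) (-(X 0 ^ 2 * X 3)) _ ?_
      simp only [map_neg, map_mul, map_pow, w0, w1, w2, w3]
      linear_combination (-y1) * h12 - x1 * h13
    have i5 : f.IsIntegralElem y2 := by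
      refine int_cubic f (-2 * X 2) (X 2 ^ 2 + X 1 * X 3) (-(X 0 * X 3 ^ 2) - X 1 * X 2 * X 3) _ ?_
      simp only [map_neg, map_mul, map_pow, map_add, map_sub, map_ofNat, w0, w1, w2, w3]
      linear_combination (-x3) * h23 - y3 * h13
    have i2 : f.IsIntegralElem x2 := by
      have := RingHom.IsIntegralElem.sub f i4 j1
      simpa using this
    have i3 : f.IsIntegralElem x3 := by
      have := RingHom.IsIntegralElem.sub f i5 j2
      simpa using this
    intro i
    fin_cases i <;> assumption
  · refine lower ((aeval ![0, 1, X 0, X 1, X 2]).comp ψ) x1 y1 y2 y3 ?_ ?_ ?_ ?_ ?_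
    · rintro rfl
      rw [map_zero] at e1
      exact mul_ne_zero (X_ne_zero _) (X_ne_zero _) e1.symm
    all_goals simp [e1, e4, e5, e6]

theorem scroll {k S : Type*} [Field k] [CommRing S] [Algebra k S]
    (c d b a y x z : S)
    (h1 : c * a = b * d) (h2 : c * x = y * d) (h3 : c * z = x * d)
    (h4 : b * x = y * a) (h5 : b * z = x * a) (h6 : y * z = x * x)
    (hg : Function.Surjective (aeval (R := k) ![c, d, b, a, y, x, z]))
    (ψ : S →ₐ[k] MvPolynomial (Fin 5) k)
    (e1 : ψ c = X 0 * X 2) (e2 : ψ d = X 1 * X 2) (e3 : ψ b = X 0 * X 3)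
    (e4 : ψ a = X 1 * X 3) (e5 : ψ y = X 0 * X 0 * X 4) (e6 : ψ x = X 0 * X 1 * X 4)
    (e7 : ψ z = X 1 * X 1 * X 4) :
    IsDomain S ∧ ringKrullDim S = 4 := by
  have hinj : Function.Injective ψ := by
    refine toric_inj _ hg (fun i => ![Finsupp.single 0 1 + Finsupp.single 2 1,
      Finsupp.single 1 1 + Finsupp.single 2 1, Finsupp.single 0 1 + Finsupp.single 3 1,
      Finsupp.single 1 1 + Finsupp.single 3 1,
      Finsupp.single 0 1 + Finsupp.single 0 1 + Finsupp.single 4 1,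
      Finsupp.single 0 1 + Finsupp.single 1 1 + Finsupp.single 4 1,
      Finsupp.single 1 1 + Finsupp.single 1 1 + Finsupp.single 4 1] i) ψ ?_ ?_
    · intro i
      fin_cases i <;> simp [e1, e2, e3, e4, e5, e6, e7, X, monomial_mul, -Finsupp.single_add]
    · intro m m' h
      rw [Finsupp.prod_fintype _ _ (by simp), Finsupp.prod_fintype _ _ (by simp)]
      rw [Finsupp.sum_fintype _ _ (by simp), Finsupp.sum_fintype _ _ (by simp)] at h
      simp only [Fin.prod_univ_seven, Fin.sum_univ_seven] at h ⊢
      have H0 := DFunLike.congr_fun h 0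
      have H2 := DFunLike.congr_fun h 2
      have H3 := DFunLike.congr_fun h 3
      have H4 := DFunLike.congr_fun h 4
      simp at H0 H2 H3 H4
      exact comb7 c d b a y x z h1 h2 h3 h4 h5 h6 _ _ _ _ _ _ _ _ _ _ _ _ _ _ _ rfl
        (by omega) (by omega) (by omega) (by omega)
  have hdom : IsDomain S := hinj.isDomain ψ.toRingHom
  refine ⟨hdom, le_antisymm ?_ ?_⟩
  · have hw : ∀ j, (aeval (R := k) ![c, d - b, a - y, z]).toRingHom (X j)
        = ![c, d - b, a - y, z] j := fun j => aeval_X _ _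
    have w0 := hw 0
    have w1 := hw 1
    have w2 := hw 2
    have w3 := hw 3
    simp only [Matrix.cons_val] at w0 w1 w2 w3
    refine upper ![c, d - b, a - y, z] _ hg ?_
    set f := (aeval (R := k) ![c, d - b, a - y, z]).toRingHom
    have i1 : f.IsIntegralElem c := w0 ▸ f.isIntegralElem_map
    have i7 : f.IsIntegralElem z := w3 ▸ f.isIntegralElem_map
    have j1 : f.IsIntegralElem (d - b) := w1 ▸ f.isIntegralElem_map
    have j2 : f.IsIntegralElem (a - y) := w2 ▸ f.isIntegralElem_map
    have i6 : f.IsIntegralElem x := by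
      refine int_quartic f 0 (X 2 * X 3) (X 1 * X 3 ^ 2) (-(X 0 * X 3 ^ 3)) _ ?_
      simp only [map_neg, map_mul, map_pow, map_zero, w0, w1, w2, w3]
      linear_combination (-x ^ 2) * h6 - z * x * h5 - z ^ 2 * h3
    have i2 : f.IsIntegralElem d := by
      refine int_quartic f (-X 1) (-(X 0 * X 2)) 0 (-(X 0 ^ 3 * X 3)) _ ?_
      simp only [map_neg, map_mul, map_pow, map_zero, w0, w1, w2, w3]
      linear_combination (-d ^ 2) * h1 - c * d * h2 - c ^ 2 * h3
    have i4 : f.IsIntegralElem a := by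
      refine int_quad f (-X 2) _ ?_
      have : a ^ 2 + f (-X 2) * a = c * z - (d - b) * x := by
        simp only [map_neg, w2]
        linear_combination (-1) * h4 - h3
      rw [this]
      exact (i1.mul _ i7).sub _ (j1.mul _ i6)
    have i3 : f.IsIntegralElem b := by
      have := RingHom.IsIntegralElem.sub f i2 j1
      simpa using this
    have i5 : f.IsIntegralElem y := by
      have := RingHom.IsIntegralElem.sub f i4 j2
      simpa using this
    intro i
    fin_cases i <;> assumption
  · refine lower ((aeval ![0, 1, X 0, X 1, X 2]).comp ψ) c d a z ?_ ?_ ?_ ?_ ?_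
    · rintro rfl
      rw [map_zero] at e1
      exact mul_ne_zero (X_ne_zero _) (X_ne_zero _) e1.symm
    all_goals simp [e1, e2, e4, e7]

end R121Aux

namespace R121Aux

lemma half_mul_two {k : Type*} [Field k] (h2 : (2 : k) ≠ 0) (S : Type*) [CommRing S]
    [Algebra k S] : algebraMap k S 2⁻¹ * 2 = 1 := by
  rw [show (2 : S) = algebraMap k S 2 from (map_ofNat (algebraMap k S) 2).symm, ← map_mul,
    inv_mul_cancel₀ h2, map_one]

/-- the projection onto a double quotient -/
noncomputable def proj {k : Type*} [Field k] (J : Ideal (RTilde121 k)) :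
    MvPolynomial (Fin 8) k →ₐ[k] RTilde121 k ⧸ J :=
  (Ideal.Quotient.mkₐ k J).comp (Ideal.Quotient.mkₐ k (idealR121 k))

lemma proj_surj {k : Type*} [Field k] (J : Ideal (RTilde121 k)) :
    Function.Surjective (proj J) :=
  (Ideal.Quotient.mkₐ_surjective k J).comp (Ideal.Quotient.mkₐ_surjective k (idealR121 k))

lemma proj_zero {k : Type*} [Field k] (J : Ideal (RTilde121 k)) {f : MvPolynomial (Fin 8) k}
    (hf : f ∈ idealR121 k) : proj J f = 0 := by
  have : Ideal.Quotient.mk (idealR121 k) f = 0 := Ideal.Quotient.eq_zero_iff_mem.mpr hf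
  simp [proj, this]

lemma proj_zero' {k : Type*} [Field k] (J : Ideal (RTilde121 k)) {f : MvPolynomial (Fin 8) k}
    (hf : Ideal.Quotient.mk (idealR121 k) f ∈ J) : proj J f = 0 :=
  Ideal.Quotient.eq_zero_iff_mem.mpr hf

/-- the relations that hold in every double quotient -/
lemma proj_rel {k : Type*} [Field k] (J : Ideal (RTilde121 k)) (P : Fin 8 → RTilde121 k ⧸ J)
    (hP : ∀ i, P i = proj J (X i)) :
    P 5 * P 0 + P 7 * P 1 - P 0 * P 4 = 0 ∧ P 6 * P 0 - P 5 * P 1 - P 1 * P 4 = 0 ∧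
    P 5 * P 2 + P 6 * P 3 + P 2 * P 4 = 0 ∧ P 7 * P 2 - P 5 * P 3 + P 3 * P 4 = 0 ∧
    P 5 ^ 2 + P 6 * P 7 - P 4 ^ 2 = 0 ∧ P 0 * P 2 + P 1 * P 3 = 0 := by
  simp only [hP, ← map_mul, ← map_add, ← map_sub, ← map_pow]
  refine ⟨?_, ?_, ?_, ?_, ?_, ?_⟩ <;> refine proj_zero J (Ideal.subset_span ?_) <;> simp

lemma exists_lift {k T : Type*} [Field k] [CommRing T] [Algebra k T] (s : Set (RTilde121 k))
    (v : Fin 8 → T)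
    (r1 : v 5 * v 0 + v 7 * v 1 - v 0 * v 4 = 0) (r2 : v 6 * v 0 - v 5 * v 1 - v 1 * v 4 = 0)
    (r3 : v 5 * v 2 + v 6 * v 3 + v 2 * v 4 = 0) (r4 : v 7 * v 2 - v 5 * v 3 + v 3 * v 4 = 0)
    (r5 : v 5 ^ 2 + v 6 * v 7 - v 4 ^ 2 = 0) (r6 : v 0 * v 2 + v 1 * v 3 = 0)
    (hs : ∀ q ∈ s, ∃ i, v i = 0 ∧ q = Ideal.Quotient.mk (idealR121 k) (X i)) :
    ∃ ψ : (RTilde121 k ⧸ Ideal.span s) →ₐ[k] T, ∀ i, ψ (proj _ (X i)) = v i := by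
  have hI : ∀ f ∈ idealR121 k, aeval (R := k) v f = 0 := by
    intro f hf
    have : idealR121 k ≤ RingHom.ker (aeval (R := k) v) := by
      refine Ideal.span_le.mpr ?_
      rintro f (rfl | rfl | rfl | rfl | rfl | rfl) <;>
        simpa [RingHom.mem_ker]
    exact this hf
  have hJ : ∀ f ∈ Ideal.span s, Ideal.Quotient.liftₐ (idealR121 k) (aeval (R := k) v) hI f = 0 := by
    intro f hf
    have : Ideal.span s ≤ RingHom.ker (Ideal.Quotient.liftₐ (idealR121 k) (aeval (R := k) v) hI) := by
      refine Ideal.span_le.mpr fun q hq => ?_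
      obtain ⟨i, hi, rfl⟩ := hs q hq
      exact (aeval_X v i).trans hi
    exact this hf
  exact ⟨Ideal.Quotient.liftₐ _ _ hJ, fun i => aeval_X v i⟩

lemma surj_of {k σ : Type*} [Field k] (J : Ideal (RTilde121 k)) (g : σ → RTilde121 k ⧸ J)
    (h : Fin 8 → MvPolynomial σ k) (hh : ∀ i, aeval g (h i) = proj J (X i)) :
    Function.Surjective (aeval (R := k) g) := by
  have : (aeval (R := k) g).comp (aeval h) = proj J := by
    ext i
    simp [hh]
  have h2 := proj_surj J
  rw [← this] at h2
  exact Function.Surjective.of_comp h2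

lemma case1 {k : Type*} [Field k] (h2 : (2 : k) ≠ 0) (J : Ideal (RTilde121 k))
    (hJ : J = Ideal.span
        ({Ideal.Quotient.mk (idealR121 k) (X 0), Ideal.Quotient.mk (idealR121 k) (X 1)} :
          Set (RTilde121 k))) :
    IsDomain (RTilde121 k ⧸ J) ∧ ringKrullDim (RTilde121 k ⧸ J) = 4 := by
  have z0 : proj J (X 0) = 0 := proj_zero' _ (hJ ▸ Ideal.subset_span (by simp))
  have z1 : proj J (X 1) = 0 := proj_zero' _ (hJ ▸ Ideal.subset_span (by simp))
  obtain ⟨r1, r2, r3, r4, r5, r6⟩ := proj_rel J _ (fun _ => rfl)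
  have hc : (C (2⁻¹) * 2 : MvPolynomial (Fin 5) k) = 1 := by
    rw [show (2 : MvPolynomial (Fin 5) k) = C 2 from (map_ofNat C 2).symm, ← C_mul,
      inv_mul_cancel₀ h2, C_1]
  have hc' := half_mul_two h2 (RTilde121 k ⧸ J)
  obtain ⟨ψ, hψ⟩ : ∃ ψ : (RTilde121 k ⧸ J) →ₐ[k] MvPolynomial (Fin 5) k,
      ∀ i, ψ (proj _ (X i)) = ![0, 0, X 0 * X 2, X 1 * X 2,
        C 2⁻¹ * (-(X 1 * X 3) - X 0 * X 4), C 2⁻¹ * (-(X 1 * X 3) + X 0 * X 4),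
        X 0 * X 3, X 1 * X 4] i := by
    subst hJ
    apply exists_lift
    · simp
    · simp
    · simp only [Matrix.cons_val]
      linear_combination (-(X 0 * X 1 * X 2 * X 3)) * hc
    · simp only [Matrix.cons_val]
      linear_combination (-(X 0 * X 1 * X 2 * X 4)) * hc
    · simp only [Matrix.cons_val]
      linear_combination (-(X 0 * X 1 * X 3 * X 4)) * (C 2⁻¹ * 2 + 1) * hc
    · simp
    · rintro q (rfl | rfl)
      · exact ⟨0, by simp, rfl⟩
      · exact ⟨1, by simp, rfl⟩
  refine generic23 (k := k) (proj J (X 2)) (proj J (X 6)) (proj J (X 5) - proj J (X 4))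
    (proj J (X 3)) (-(proj J (X 5) + proj J (X 4))) (proj J (X 7)) ?_ ?_ ?_ ?_ ψ ?_ ?_ ?_ ?_ ?_ ?_
  · linear_combination (-1) * r3
  · linear_combination r4
  · linear_combination r5
  · refine surj_of J _ ![0, 0, X 0, X 3, C 2⁻¹ * (-X 4 - X 2), C 2⁻¹ * (-X 4 + X 2), X 1, X 5] ?_
    intro i
    fin_cases i
    · simp [z0]
    · simp [z1]
    · simp
    · simp
    · simp
      linear_combination (proj J (X 4)) * hc'
    · simp
      linear_combination (proj J (X 5)) * hc'
    · simp
    · simp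
  · simp [hψ]
  · simp [hψ]
  · simp only [map_sub, hψ, Matrix.cons_val]
    linear_combination (X 0 * X 4) * hc
  · simp [hψ]
  · simp only [map_neg, map_add, hψ, Matrix.cons_val]
    linear_combination (X 1 * X 3) * hc
  · simp [hψ]

lemma case2 {k : Type*} [Field k] (h2 : (2 : k) ≠ 0) (J : Ideal (RTilde121 k))
    (hJ : J = Ideal.span
        ({Ideal.Quotient.mk (idealR121 k) (X 2), Ideal.Quotient.mk (idealR121 k) (X 3)} :
          Set (RTilde121 k))) :
    IsDomain (RTilde121 k ⧸ J) ∧ ringKrullDim (RTilde121 k ⧸ J) = 4 := by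
  have z0 : proj J (X 2) = 0 := proj_zero' _ (hJ ▸ Ideal.subset_span (by simp))
  have z1 : proj J (X 3) = 0 := proj_zero' _ (hJ ▸ Ideal.subset_span (by simp))
  obtain ⟨r1, r2, r3, r4, r5, r6⟩ := proj_rel J _ (fun _ => rfl)
  have hc : (C (2⁻¹) * 2 : MvPolynomial (Fin 5) k) = 1 := by
    rw [show (2 : MvPolynomial (Fin 5) k) = C 2 from (map_ofNat C 2).symm, ← C_mul,
      inv_mul_cancel₀ h2, C_1]
  have hc' := half_mul_two h2 (RTilde121 k ⧸ J)
  obtain ⟨ψ, hψ⟩ : ∃ ψ : (RTilde121 k ⧸ J) →ₐ[k] MvPolynomial (Fin 5) k,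
      ∀ i, ψ (proj _ (X i)) = ![X 0 * X 2, X 1 * X 2, 0, 0,
        C 2⁻¹ * (X 0 * X 4 + X 1 * X 3), C 2⁻¹ * (X 0 * X 4 - X 1 * X 3),
        X 1 * X 4, X 0 * X 3] i := by
    subst hJ
    apply exists_lift
    · simp only [Matrix.cons_val]
      linear_combination (-(X 0 * X 1 * X 2 * X 3)) * hc
    · simp only [Matrix.cons_val]
      linear_combination (-(X 0 * X 1 * X 2 * X 4)) * hc
    · simp
    · simp
    · simp only [Matrix.cons_val]
      linear_combination (-(X 0 * X 1 * X 3 * X 4)) * (C 2⁻¹ * 2 + 1) * hc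
    · simp
    · rintro q (rfl | rfl)
      · exact ⟨2, by simp, rfl⟩
      · exact ⟨3, by simp, rfl⟩
  refine generic23 (k := k) (proj J (X 0)) (proj J (X 7)) (proj J (X 5) + proj J (X 4))
    (proj J (X 1)) (-(proj J (X 5) - proj J (X 4))) (proj J (X 6)) ?_ ?_ ?_ ?_ ψ ?_ ?_ ?_ ?_ ?_ ?_
  · linear_combination (-1) * r1
  · linear_combination r2
  · linear_combination r5
  · refine surj_of J _ ![X 0, X 3, 0, 0, C 2⁻¹ * (X 2 + X 4), C 2⁻¹ * (X 2 - X 4), X 5, X 1] ?_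
    intro i
    fin_cases i
    · simp
    · simp
    · simp [z0]
    · simp [z1]
    · simp
      linear_combination (proj J (X 4)) * hc'
    · simp
      linear_combination (proj J (X 5)) * hc'
    · simp
    · simp
  · simp [hψ]
  · simp [hψ]
  · simp only [map_add, hψ, Matrix.cons_val]
    linear_combination (X 0 * X 4) * hc
  · simp [hψ]
  · simp only [map_neg, map_sub, hψ, Matrix.cons_val]
    linear_combination (X 1 * X 3) * hc
  · simp [hψ]

lemma case3 {k : Type*} [Field k] (J : Ideal (RTilde121 k))
    (hJ : J = Ideal.span ({Ideal.Quotient.mk (idealR121 k) (X 4)} : Set (RTilde121 k))) :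
    IsDomain (RTilde121 k ⧸ J) ∧ ringKrullDim (RTilde121 k ⧸ J) = 4 := by
  have z0 : proj J (X 4) = 0 := proj_zero' _ (hJ ▸ Ideal.subset_span (by simp))
  obtain ⟨r1, r2, r3, r4, r5, r6⟩ := proj_rel J _ (fun _ => rfl)
  simp only [z0] at r1 r2 r3 r4 r5 r6
  obtain ⟨ψ, hψ⟩ : ∃ ψ : (RTilde121 k ⧸ J) →ₐ[k] MvPolynomial (Fin 5) k,
      ∀ i, ψ (proj _ (X i)) = ![X 1 * X 3, -(X 0 * X 3), X 0 * X 2, X 1 * X 2, 0,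
        X 0 * X 1 * X 4, -(X 0 * X 0 * X 4), X 1 * X 1 * X 4] i := by
    subst hJ
    apply exists_lift
    iterate 6
      · simp only [Matrix.cons_val]
        ring
    · rintro q rfl
      exact ⟨4, by simp, rfl⟩
  refine scroll (k := k) (proj J (X 2)) (proj J (X 3)) (-proj J (X 1)) (proj J (X 0))
    (-proj J (X 6)) (proj J (X 5)) (proj J (X 7)) ?_ ?_ ?_ ?_ ?_ ?_ ?_ ψ ?_ ?_ ?_ ?_ ?_ ?_ ?_
  · linear_combination r6
  · linear_combination r3
  · linear_combination r4
  · linear_combination r2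
  · linear_combination (-1) * r1
  · linear_combination (-1) * r5
  · refine surj_of J _ ![X 3, -X 2, X 0, X 1, 0, X 5, -X 4, X 6] ?_
    intro i
    fin_cases i <;> simp [z0]
  all_goals simp [hψ]

end R121Aux

/-- For a field `k` of characteristic `0` or at least `5`, each of
`R̃^{1,2,1}_k/(A,B)`, `R̃^{1,2,1}_k/(C,D)` and `R̃^{1,2,1}_k/(R)` is an integral domain of
Krull dimension `4`. -/
theorem rTilde121_quotients_domain (k : Type*) [Field k]
    (hchar : ringChar k = 0 ∨ 5 ≤ ringChar k) :
    (IsDomain (RTilde121 k ⧸ Ideal.span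
        ({Ideal.Quotient.mk (idealR121 k) (X 0), Ideal.Quotient.mk (idealR121 k) (X 1)} :
          Set (RTilde121 k))) ∧
      ringKrullDim (RTilde121 k ⧸ Ideal.span
        ({Ideal.Quotient.mk (idealR121 k) (X 0), Ideal.Quotient.mk (idealR121 k) (X 1)} :
          Set (RTilde121 k))) = 4) ∧
    (IsDomain (RTilde121 k ⧸ Ideal.span
        ({Ideal.Quotient.mk (idealR121 k) (X 2), Ideal.Quotient.mk (idealR121 k) (X 3)} :
          Set (RTilde121 k))) ∧
      ringKrullDim (RTilde121 k ⧸ Ideal.span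
        ({Ideal.Quotient.mk (idealR121 k) (X 2), Ideal.Quotient.mk (idealR121 k) (X 3)} :
          Set (RTilde121 k))) = 4) ∧
    (IsDomain (RTilde121 k ⧸ Ideal.span
        ({Ideal.Quotient.mk (idealR121 k) (X 4)} : Set (RTilde121 k))) ∧
      ringKrullDim (RTilde121 k ⧸ Ideal.span
        ({Ideal.Quotient.mk (idealR121 k) (X 4)} : Set (RTilde121 k))) = 4) := by
  have h2 : (2 : k) ≠ 0 := by
    intro h
    have h' : ((2 : ℕ) : k) = 0 := by exact_mod_cast h
    rw [ringChar.spec] at h'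
    rcases hchar with h0 | h5
    · rw [h0] at h'
      omega
    · have := Nat.le_of_dvd (by norm_num) h'
      omega
  exact ⟨R121Aux.case1 h2 _ rfl, R121Aux.case2 h2 _ rfl, R121Aux.case3 _ rfl⟩
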